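/- Let σ and ρ be primitive invertible substitutions on the two-letter alphabet 𝒜 = {a,b} with the same inflation factor. Then the following are equivalent: (i) σ ~ ρ; (ii) X_σ = X_ρ; (iii) σ and ρ have the same frequency α. -/

import Mathlib

open scoped Matrix

/-- The two-letter alphabet `𝒜 = {a, b}`; the letter `a` is `0` and the letter `b` is `1`. -/
abbrev A2 := Fin 2

/-- A substitution on the two-letter alphabet, given by the images of the two letters.
(The nonerasing condition is stated separately as `TwoSubst.NonErasing`.) -/
abbrev Subst := A2 → List A2

namespace TwoSubst

/-- A substitution is non-erasing if the images of the letters are nonempty words. -/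
def NonErasing (σ : Subst) : Prop := ∀ i : A2, σ i ≠ []

/-- The extension of a substitution to finite words (the morphism of the free monoid). -/
def apply (σ : Subst) (w : List A2) : List A2 := w.flatMap σ

/-- The `n`-th power `σ^n` of a substitution (as a substitution). -/
def substPow (σ : Subst) (n : ℕ) : Subst := fun i => (apply σ)^[n] [i]

/-- Composition of substitutions: `(σ ∘ τ)(i) = σ(τ(i))`. -/
def comp (σ τ : Subst) : Subst := fun i => apply σ (τ i)

/-- The substitution matrix `M_σ`: entry `(i, j)` is the number of occurrences of the
letter `i` in `σ(j)`. -/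
def M (σ : Subst) : Matrix (Fin 2) (Fin 2) ℤ := fun i j => ((σ j).count i : ℤ)

/-- A substitution is primitive if some power of its substitution matrix has all
entries positive. -/
def Primitive (σ : Subst) : Prop := ∃ n : ℕ, 0 < n ∧ ∀ i j, 0 < (M σ ^ n) i j

/-- A finite word, regarded as an element of the free group `F₂`. -/
def toFG (w : List A2) : FreeGroup A2 := (w.map FreeGroup.of).prod

/-- The endomorphism of the free group `F₂` induced by a substitution. -/
def endo (σ : Subst) : Monoid.End (FreeGroup A2) := FreeGroup.lift fun i => toFG (σ i)

/-- A substitution is invertible if its extension to the free group `F₂` is an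
automorphism of `F₂`. -/
def IsInvertible (σ : Subst) : Prop := Function.Bijective (endo σ)

/-- Two substitutions are conjugate, `σ ~ ρ`, if `σ = γ_w ∘ ρ` as endomorphisms of `F₂`
for some `w ∈ F₂`, where `γ_w x = w * x * w⁻¹`. -/
def Conj (σ ρ : Subst) : Prop := ∃ w : FreeGroup A2, ∀ x, endo σ x = w * endo ρ x * w⁻¹

/-- `w` is a (finite) factor of the bi-infinite word `u : ℤ → A2`. -/
def IsFactor (w : List A2) (u : ℤ → A2) : Prop :=
  ∃ k : ℤ, w = (List.range w.length).map fun i => u (k + i)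

/-- The hull `X_σ`: the set of bi-infinite words all of whose finite factors appear as
factors of `σ^n(a)` or `σ^n(b)` for some `n ∈ ℕ`. -/
def Hull (σ : Subst) : Set (ℤ → A2) :=
  { u | ∀ w : List A2, IsFactor w u → ∃ (n : ℕ) (x : A2), w <:+: substPow σ n x }

/-- The substitution `E : a ↦ b, b ↦ a`. -/
def Esub : Subst := ![[1], [0]]

/-- The substitution `L : a ↦ a, b ↦ ab`. -/
def Lsub : Subst := ![[0], [0, 1]]

/-- The composition `L^{a₁} ∘ E ∘ L^{a₂} ∘ E ∘ ⋯ ∘ E ∘ L^{a_m}` encoded by the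
nonempty list of exponents `a₁ :: [a₂, …, a_m]`. -/
def chain : ℕ → List ℕ → Subst
  | a, [] => substPow Lsub a
  | a, b :: rest => comp (substPow Lsub a) (comp Esub (chain b rest))

/-- The letter-exchange map `a ↦ b, b ↦ a` on letters. -/
def swapA : A2 → A2 := fun i => if i = 0 then 1 else 0

/-- The substitution matrix with real entries. -/
noncomputable def Mreal (σ : Subst) : Matrix (Fin 2) (Fin 2) ℝ := (M σ).map fun z => (z : ℝ)

/-- `lam` is the inflation factor (Perron–Frobenius eigenvalue) of `σ`: it is an
eigenvalue of `M_σ` admitting a positive eigenvector. -/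
def IsInflation (σ : Subst) (lam : ℝ) : Prop :=
  ∃ v : Fin 2 → ℝ, (∀ i, 0 < v i) ∧ (Mreal σ).mulVec v = lam • v

/-- `α` is the frequency of `σ`: `α ∈ (0,1)` and `(1-α, α)` is an eigenvector of `M_σ`
for an eigenvalue with positive eigenvector (necessarily the Perron-Frobenius
eigenvalue, i.e. the inflation factor, when `σ` is primitive). -/
def IsFreq (σ : Subst) (α : ℝ) : Prop :=
  0 < α ∧ α < 1 ∧ ∃ lam : ℝ, (Mreal σ).mulVec ![1 - α, α] = lam • ![1 - α, α]

/-- The automorphism `τ_a : a ↦ a⁻¹, b ↦ b` of the free group `F₂`. -/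
def tauA : Monoid.End (FreeGroup A2) :=
  FreeGroup.lift fun i : A2 => if i = 0 then (FreeGroup.of (0 : A2))⁻¹ else FreeGroup.of 1

/-- `ρ` is the reciprocal substitution `σ̄ = τ_a ∘ σ⁻¹ ∘ τ_a⁻¹` of `σ`, where
`φ` is the inverse automorphism `σ⁻¹` (note `τ_a⁻¹ = τ_a`). -/
def IsReciprocal (σ ρ : Subst) (φ : Monoid.End (FreeGroup A2)) : Prop :=
  (∀ x, φ (endo σ x) = x) ∧ (∀ x, endo σ (φ x) = x) ∧
    NonErasing ρ ∧ ∀ x, endo ρ x = tauA (φ (tauA x))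

/-- `σ` is a selfdual substitution (relative to its reciprocal `ρ = σ̄`):
`σ ~ σ̄` or `σ ~ E ∘ σ̄ ∘ E`. -/
def SelfDual (σ ρ : Subst) : Prop :=
  Conj σ ρ ∨ Conj σ (comp Esub (comp ρ Esub))

/-! ### Strands and dual maps -/

/-- Integer vectors in the plane. -/
abbrev V2 := Fin 2 → ℤ

/-- The abelianisation map `A : 𝒜* → ℤ²`, counting occurrences of each letter. -/
def Avec (w : List A2) : V2 := fun i => (w.count i : ℤ)

/-- The space `𝒢` (and its dual `𝒢*`): formal finite real linear combinations of the
basis elements `(W, i)` (resp. `(W, i*)`), `W ∈ ℤ²`, `i ∈ 𝒜`. -/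
abbrev Gspace := (V2 × A2) →₀ ℝ

/-- The image of the basis element `(W, i)` under `E₁(σ)`. -/
noncomputable def E1Basis (σ : Subst) (p : V2 × A2) : Gspace :=
  ∑ k ∈ Finset.range (σ p.2).length,
    Finsupp.single ((M σ).mulVec p.1 + Avec ((σ p.2).take k), (σ p.2).getD k p.2) (1 : ℝ)

/-- The one-dimensional extension `E₁(σ)`, as a linear map on `𝒢`. -/
noncomputable def E1 (σ : Subst) : Gspace →ₗ[ℝ] Gspace :=
  Finsupp.lift Gspace ℝ (V2 × A2) (E1Basis σ)

/-- The image of the basis element `(W, i*)` under the dual map `E₁*(σ)`: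
`E₁*(σ)(W, i*) = Σ_{j,k : σ(j)_k = i} (M_σ⁻¹·(W + A(σ(j)_{k+1}⋯σ(j)_{|σ(j)|})), j*)`. -/
noncomputable def E1starBasis (σ : Subst) (p : V2 × A2) : Gspace :=
  ∑ j : A2, ∑ k ∈ Finset.range (σ j).length,
    if (σ j).getD k j = p.2 then
      Finsupp.single ((M σ)⁻¹.mulVec (p.1 + Avec ((σ j).drop (k + 1))), j) (1 : ℝ)
    else 0

/-- The dual map `E₁*(σ)`, as a linear map on `𝒢*`. -/
noncomputable def E1star (σ : Subst) : Gspace →ₗ[ℝ] Gspace :=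
  Finsupp.lift Gspace ℝ (V2 × A2) (E1starBasis σ)

/-- The basis vector `e_a = (1,0)`. -/
def ea : V2 := ![1, 0]

/-- The basis vector `e_b = (0,1)`. -/
def eb : V2 := ![0, 1]

/-- `γ(0), …, γ(n)` is a finite dual strand: each step is `e_a` or `-e_b`. -/
def IsDualStrand (n : ℕ) (γ : ℕ → V2) : Prop :=
  ∀ k < n, γ (k + 1) - γ k = ea ∨ γ (k + 1) - γ k = -eb

/-- The element of `𝒢*` associated with a finite dual strand `γ(0), …, γ(n)`:
the sum of `(γ(k), b*)` over the `e_a`-steps and `(γ(k+1), a*)` over the `-e_b`-steps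
(the letter `a` is `0`, the letter `b` is `1`). -/
noncomputable def strandElem (n : ℕ) (γ : ℕ → V2) : Gspace :=
  ∑ k ∈ Finset.range n,
    if γ (k + 1) - γ k = ea then Finsupp.single (γ k, (1 : A2)) (1 : ℝ)
    else Finsupp.single (γ (k + 1), (0 : A2)) (1 : ℝ)

/-! ### Endomorphisms of the free group -/

/-- The exponent-sum homomorphism of the generator `i` on `F₂`. -/
def expSum (i : A2) : FreeGroup A2 →* Multiplicative ℤ :=
  FreeGroup.lift fun j : A2 => Multiplicative.ofAdd (if j = i then (1 : ℤ) else 0)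

/-- The abelianised matrix of an endomorphism of `F₂`: entry `(i,j)` is the exponent
sum of the generator `i` in the image of the generator `j`. -/
def abelMatrix (σ : Monoid.End (FreeGroup A2)) : Matrix (Fin 2) (Fin 2) ℤ :=
  fun i j => Multiplicative.toAdd (expSum i (σ (FreeGroup.of j)))

/-- `wprod ρ w k = w · ρ(w) · ρ²(w) ⋯ ρ^{k−1}(w)`. -/
def wprod (ρ : Monoid.End (FreeGroup A2)) (w : FreeGroup A2) : ℕ → FreeGroup A2
  | 0 => 1
  | k + 1 => wprod ρ w k * (ρ ^ k) w

end TwoSubst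

namespace TwoSubst

theorem apply_nil (σ : Subst) : apply σ [] = [] := rfl
theorem apply_cons (σ : Subst) (x : A2) (w : List A2) : apply σ (x :: w) = σ x ++ apply σ w := by
  simp [apply]
theorem apply_append (σ : Subst) (v w : List A2) :
    apply σ (v ++ w) = apply σ v ++ apply σ w := by
  simp [apply]
theorem iter_append (σ : Subst) (n : ℕ) (v w : List A2) :
    (apply σ)^[n] (v ++ w) = (apply σ)^[n] v ++ (apply σ)^[n] w := by
  induction n generalizing v w with
  | zero => rfl
  | succ n ih => simp only [Function.iterate_succ_apply, apply_append, ih]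
theorem length_apply (σ : Subst) (h : NonErasing σ) (w : List A2) :
    w.length ≤ (apply σ w).length := by
  induction w with
  | nil => simp
  | cons x w ih =>
    have := List.length_pos_iff.2 (h x)
    simp only [apply_cons, List.length_append, List.length_cons]; omega
theorem length_iter (σ : Subst) (h : NonErasing σ) (n : ℕ) (w : List A2) :
    w.length ≤ ((apply σ)^[n] w).length := by
  induction n generalizing w with
  | zero => simp
  | succ n ih =>
    rw [Function.iterate_succ_apply]
    exact (length_apply σ h w).trans (ih _)

theorem toFG_append (v w : List A2) : toFG (v ++ w) = toFG v * toFG w := by simp [toFG]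
theorem toFG_cons (x : A2) (w : List A2) : toFG (x :: w) = FreeGroup.of x * toFG w := by
  simp [toFG]
theorem toFG_nil : toFG [] = 1 := rfl
theorem toFG_single (x : A2) : toFG [x] = FreeGroup.of x := by simp [toFG]
theorem endo_of (σ : Subst) (x : A2) : endo σ (FreeGroup.of x) = toFG (σ x) := by
  simp only [endo]
  exact FreeGroup.lift_apply_of
theorem endo_toFG (σ : Subst) (w : List A2) : endo σ (toFG w) = toFG (apply σ w) := by
  induction w with
  | nil => simp [toFG_nil, apply_nil]
  | cons x w ih => rw [toFG_cons, map_mul, endo_of, ih, apply_cons, toFG_append]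
theorem iter_toFG (σ : Subst) (n : ℕ) (w : List A2) :
    (endo σ)^[n] (toFG w) = toFG ((apply σ)^[n] w) := by
  induction n generalizing w with
  | zero => rfl
  | succ n ih => rw [Function.iterate_succ_apply, Function.iterate_succ_apply, endo_toFG, ih]

/-- positive word as list of signed letters -/
def pos (w : List A2) : List (A2 × Bool) := w.map fun x => (x, true)
/-- inverse of a positive word as list of signed letters -/
def neg (w : List A2) : List (A2 × Bool) := (w.map fun x => (x, false)).reverse

theorem pos_append (v w : List A2) : pos (v ++ w) = pos v ++ pos w := by simp [pos]
theorem neg_append (v w : List A2) : neg (v ++ w) = neg w ++ neg v := by simp [neg]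

theorem mk_pos (w : List A2) : FreeGroup.mk (pos w) = toFG w := by
  induction w with
  | nil => rfl
  | cons x w ih =>
    rw [toFG_cons, ← ih]
    simp [pos, FreeGroup.of, FreeGroup.mul_mk]
theorem mk_neg (w : List A2) : FreeGroup.mk (neg w) = (toFG w)⁻¹ := by
  rw [← mk_pos, FreeGroup.inv_mk]
  congr 1
  simp [neg, pos, FreeGroup.invRev, Function.comp_def]

theorem isReduced_pos (w : List A2) : FreeGroup.IsReduced (pos w) := by
  unfold FreeGroup.IsReduced pos
  rw [List.isChain_map]
  induction w with
  | nil => simp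
  | cons x w ih => cases w <;> simp_all
theorem isReduced_neg (w : List A2) : FreeGroup.IsReduced (neg w) := by
  unfold FreeGroup.IsReduced neg
  rw [← List.map_reverse, List.isChain_map]
  induction w.reverse with
  | nil => simp
  | cons x w ih => cases w <;> simp_all
theorem toWord_toFG (w : List A2) : (toFG w).toWord = pos w := by
  rw [← mk_pos, FreeGroup.toWord_mk, (isReduced_pos w).reduce_eq]
theorem pos_inj {v w : List A2} (h : pos v = pos w) : v = w := by
  refine List.map_injective_iff.2 ?_ h
  intro x y h; simpa using h
theorem toFG_inj {v w : List A2} (h : toFG v = toFG w) : v = w := by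
  apply pos_inj; rw [← toWord_toFG, h, toWord_toFG]

/-! cancellation -/
theorem left_mul (l : List (A2 × Bool)) (g : FreeGroup A2) (A Y : List (A2 × Bool))
    (hg : g.toWord = A ++ Y) (hl : l.length ≤ A.length) :
    ∃ A', (FreeGroup.mk l * g).toWord = A' ++ Y ∧ A.length ≤ A'.length + l.length := by
  induction l with
  | nil => exact ⟨A, by rw [← FreeGroup.one_eq_mk, one_mul, hg], by simp⟩
  | cons c l ih =>
    simp only [List.length_cons] at hl
    obtain ⟨A', h1, h2⟩ := ih (by omega)
    have e : FreeGroup.mk (c :: l) * g = FreeGroup.mk [c] * (FreeGroup.mk l * g) := by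
      rw [← mul_assoc, FreeGroup.mul_mk]; rfl
    have e2 : (FreeGroup.mk (c :: l) * g).toWord
        = FreeGroup.reduce (c :: (FreeGroup.mk l * g).toWord) := by
      rw [e, FreeGroup.toWord_mul]
      rfl
    have hr := FreeGroup.reduce_toWord (FreeGroup.mk l * g)
    rw [e2, FreeGroup.reduce.cons, hr, h1]
    cases A' with
    | nil => simp at h2; omega
    | cons d A' =>
      simp only [List.cons_append, List.length_cons] at *
      split_ifs
      · exact ⟨A', rfl, by omega⟩
      · exact ⟨c :: d :: A', rfl, by simp; omega⟩

theorem right_mul (l : List (A2 × Bool)) (g : FreeGroup A2) (Y B : List (A2 × Bool))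
    (hg : g.toWord = Y ++ B) (hl : l.length ≤ B.length) :
    ∃ B', (g * FreeGroup.mk l).toWord = Y ++ B' := by
  obtain ⟨A', h1, -⟩ := left_mul (FreeGroup.invRev l) g⁻¹ (FreeGroup.invRev B) (FreeGroup.invRev Y)
    (by rw [FreeGroup.toWord_inv, hg]; simp [FreeGroup.invRev]) (by simpa using hl)
  refine ⟨FreeGroup.invRev A', ?_⟩
  have : g * FreeGroup.mk l = (FreeGroup.mk (FreeGroup.invRev l) * g⁻¹)⁻¹ := by
    rw [← FreeGroup.inv_mk]; simp
  rw [this, FreeGroup.toWord_inv, h1]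
  simp [FreeGroup.invRev, Function.comp_def]

theorem infix_of_conj (W : FreeGroup A2) (P X Q S : List A2)
    (h : toFG S = W * toFG (P ++ X ++ Q) * W⁻¹)
    (hP : W.norm ≤ P.length) (hQ : W.norm ≤ Q.length) : X <:+: S := by
  obtain ⟨A', h1, -⟩ := left_mul W.toWord (toFG (P ++ X ++ Q)) (pos P) (pos X ++ pos Q)
    (by rw [toWord_toFG, pos_append, pos_append, List.append_assoc]) (by simpa [pos, FreeGroup.norm] using hP)
  obtain ⟨B', h2⟩ := right_mul (W⁻¹).toWord _ (A' ++ pos X) (pos Q)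
    (by rw [h1, List.append_assoc]) (by
      have : W⁻¹.norm ≤ Q.length := by rwa [FreeGroup.norm_inv_eq]
      simpa [pos, FreeGroup.norm] using this)
  rw [FreeGroup.mk_toWord, FreeGroup.mk_toWord, ← h, toWord_toFG] at h2
  have h3 : pos X <:+: pos S := ⟨A', B', h2.symm⟩
  have h4 := h3.map Prod.fst
  simpa [pos, Function.comp_def] using h4

/-! conjugacy implies equal hulls -/
theorem conj_iter {σ ρ : Subst} (h : Conj σ ρ) (n : ℕ) :
    ∃ W : FreeGroup A2, ∀ x, (endo σ)^[n] x = W * (endo ρ)^[n] x * W⁻¹ := by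
  obtain ⟨w, hw⟩ := h
  induction n with
  | zero => exact ⟨1, by simp⟩
  | succ n ih =>
    obtain ⟨W, hW⟩ := ih
    refine ⟨w * endo ρ W, fun x => ?_⟩
    rw [Function.iterate_succ_apply', Function.iterate_succ_apply', hW, hw]
    simp [mul_assoc]

theorem conj_symm {σ ρ : Subst} (h : Conj σ ρ) : Conj ρ σ := by
  obtain ⟨w, hw⟩ := h
  refine ⟨w⁻¹, fun x => ?_⟩
  rw [hw]; group

theorem Avec_apply (σ : Subst) (w : List A2) : Avec (apply σ w) = (M σ).mulVec (Avec w) := by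
  induction w with
  | nil => ext i; simp [Avec, apply, Matrix.mulVec, dotProduct]
  | cons x w ih =>
    ext i
    have := congrFun ih i
    simp only [Avec, apply_cons, List.count_append, Matrix.mulVec, dotProduct, Fin.sum_univ_two, M,
      List.count_cons] at this ⊢
    push_cast
    rw [this]
    fin_cases x <;> simp <;> ring
theorem Avec_iter (σ : Subst) (n : ℕ) (w : List A2) :
    Avec ((apply σ)^[n] w) = (M σ ^ n).mulVec (Avec w) := by
  induction n with
  | zero => simp
  | succ n ih =>
    rw [Function.iterate_succ_apply', Avec_apply, ih, Matrix.mulVec_mulVec, pow_succ']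

theorem exists_mem_iter {σ : Subst} (h : Primitive σ) :
    ∃ k : ℕ, ∀ x y : A2, y ∈ (apply σ)^[k] [x] := by
  obtain ⟨n, -, hn⟩ := h
  refine ⟨n, fun x y => ?_⟩
  have h1 := congrFun (Avec_iter σ n [x]) y
  have h2 := hn y x
  rw [← List.count_pos_iff]
  have : Avec [x] = Pi.single x 1 := by
    ext i; fin_cases x <;> fin_cases i <;> simp [Avec]
  rw [this, Matrix.mulVec_single_one] at h1
  simp only [Avec, Matrix.col_apply] at h1
  omega

theorem two_le_of_all_mem (w : List A2) (h : ∀ y, y ∈ w) : 2 ≤ w.length := by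
  have h0 := List.count_pos_iff.2 (h 0)
  have h1 := List.count_pos_iff.2 (h 1)
  match w, h0, h1 with
  | [x], h0, h1 => fin_cases x <;> simp at h0 h1
  | x :: y :: w, _, _ => simp
  
theorem length_double {σ : Subst} {k : ℕ} (h : ∀ x y : A2, y ∈ (apply σ)^[k] [x])
    (w : List A2) : 2 * w.length ≤ ((apply σ)^[k] w).length := by
  induction w with
  | nil => simp
  | cons x w ih =>
    rw [← List.singleton_append, iter_append, List.length_append, List.length_append]
    have := two_le_of_all_mem _ (h x)
    simp; omega

theorem length_grow {σ : Subst} {k : ℕ} (h : ∀ x y : A2, y ∈ (apply σ)^[k] [x])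
    (N : ℕ) (w : List A2) (hw : w ≠ []) : N ≤ ((apply σ)^[k * N] w).length := by
  have : 0 < w.length := List.length_pos_iff.2 hw
  have : 2 ^ N * w.length ≤ ((apply σ)^[k * N] w).length := by
    induction N with
    | zero => simp
    | succ N ih =>
      rw [Nat.mul_succ, Nat.add_comm (k * N), Function.iterate_add_apply]
      have := length_double h ((apply σ)^[k * N] w)
      rw [pow_succ]; linarith
  have := Nat.lt_two_pow_self (n := N)
  nlinarith

theorem all_mem_grow {σ : Subst} {k : ℕ} (h : ∀ x y : A2, y ∈ (apply σ)^[k] [x])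
    (N : ℕ) (w : List A2) (hw : w ≠ []) (y : A2) : y ∈ (apply σ)^[k * (N+1)] w := by
  rw [Nat.mul_succ, Nat.add_comm (k * N), Function.iterate_add_apply]
  have : (apply σ)^[k * N] w ≠ [] := by
    rcases N with _ | N
    · simpa
    · intro h0
      have := length_grow h (N+1) w hw
      simp [h0] at this
  obtain ⟨x, t, ht⟩ := List.exists_cons_of_ne_nil this
  rw [ht, ← List.singleton_append, iter_append]
  exact List.mem_append_left _ (h x y)

theorem lang_sub {σ ρ : Subst} (hneρ : NonErasing ρ) (hσ : Primitive σ)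
    (h : Conj σ ρ) (t : List A2) (m : ℕ) (x : A2) (ht : t <:+: substPow ρ m x) :
    ∃ (n : ℕ) (y : A2), t <:+: substPow σ n y := by
  obtain ⟨W, hW⟩ := conj_iter h m
  obtain ⟨k, hk⟩ := exists_mem_iter hσ
  have hz := length_grow hk 3 [0] (by simp)
  obtain ⟨z1, z2, z3, hz', h1, h2, h3⟩ : ∃ z1 z2 z3, (apply σ)^[k * 3] [0] = z1 ++ z2 ++ z3 ∧
      z1 ≠ [] ∧ z2 ≠ [] ∧ z3 ≠ [] := by
    match (apply σ)^[k * 3] [0], hz with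
    | a :: b :: c :: l, _ => exact ⟨[a], [b], c :: l, by simp, by simp, by simp, by simp⟩
  have key : (apply σ)^[m + (k * (W.norm + 1) + k * 3)] [0] =
      (apply σ)^[m] ((apply σ)^[k * (W.norm + 1)] z1 ++ (apply σ)^[k * (W.norm + 1)] z2 ++
        (apply σ)^[k * (W.norm + 1)] z3) := by
    rw [Function.iterate_add_apply, Function.iterate_add_apply, hz', iter_append σ (k * (W.norm + 1)), iter_append σ (k * (W.norm + 1))]
  have l1 := length_grow hk (W.norm + 1) z1 h1
  have l3 := length_grow hk (W.norm + 1) z3 h3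
  obtain ⟨p, q, hpq⟩ := List.append_of_mem (all_mem_grow hk W.norm z2 h2 x)
  rw [hpq] at key
  refine ⟨m + (k * (W.norm + 1) + k * 3), 0, ht.trans ?_⟩
  unfold substPow
  generalize (apply σ)^[k * (W.norm + 1)] z1 = P at *
  generalize (apply σ)^[k * (W.norm + 1)] z3 = Q at *
  apply infix_of_conj W ((apply ρ)^[m] (P ++ p)) _ ((apply ρ)^[m] (q ++ Q))
  · rw [key, ← iter_toFG, hW, iter_toFG, ← iter_append, ← iter_append]
    simp
  · have := length_iter ρ hneρ m (P ++ p)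
    simp only [List.length_append] at this ⊢
    omega
  · have := length_iter ρ hneρ m (q ++ Q)
    simp only [List.length_append] at this ⊢
    omega

theorem hull_sub {σ ρ : Subst} (hneρ : NonErasing ρ) (hσ : Primitive σ)
    (h : Conj σ ρ) : Hull ρ ⊆ Hull σ := by
  intro u hu w hw
  obtain ⟨n, x, hx⟩ := hu w hw
  exact lang_sub hneρ hσ h w n x hx

end TwoSubst
namespace TwoSubst

theorem two_cases {i j : A2} (h : i ≠ j) (k : A2) : k = i ∨ k = j := by
  revert i j k; decide

theorem decomp (n : ℕ) : ∀ u v : List A2, u.length ≤ n → ∃ p u' v' s : List A2,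
    u = p ++ u' ++ s ∧ v = p ++ v' ++ s ∧ (u' = [] ∨ v' = [] ∨
      (u' ≠ [] ∧ v' ≠ [] ∧ u'.head? ≠ v'.head? ∧ u'.getLast? ≠ v'.getLast?)) := by
  induction n with
  | zero =>
    intro u v hu
    exact ⟨[], u, v, [], by simp, by simp, Or.inl (by simpa using hu)⟩
  | succ n ih =>
    intro u v hu
    by_cases hu0 : u = []
    · exact ⟨[], u, v, [], by simp, by simp, Or.inl hu0⟩
    by_cases hv0 : v = []
    · exact ⟨[], u, v, [], by simp, by simp, Or.inr (Or.inl hv0)⟩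
    by_cases hh : u.head? = v.head?
    · obtain ⟨x, u1, rfl⟩ := List.exists_cons_of_ne_nil hu0
      obtain ⟨y, v1, rfl⟩ := List.exists_cons_of_ne_nil hv0
      obtain rfl : x = y := by simpa using hh
      obtain ⟨p, u', v', s, h1, h2, h3⟩ := ih u1 v1 (by simpa using hu)
      exact ⟨x :: p, u', v', s, by simp [h1], by simp [h2], h3⟩
    by_cases hl : u.getLast? = v.getLast?
    · obtain ⟨u1, x, rfl⟩ := List.eq_nil_or_concat u |>.resolve_left hu0
      obtain ⟨v1, y, rfl⟩ := List.eq_nil_or_concat v |>.resolve_left hv0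
      obtain rfl : x = y := by simpa using hl
      obtain ⟨p, u', v', s, h1, h2, h3⟩ := ih u1 v1 (by simpa using hu)
      exact ⟨p, u', v', s ++ [x], by simp [h1], by simp [h2], h3⟩
    exact ⟨[], u, v, [], by simp, by simp, Or.inr (Or.inr ⟨hu0, hv0, hh, hl⟩)⟩

theorem red_app {A B : List (A2 × Bool)} (hA : FreeGroup.IsReduced A) (hB : FreeGroup.IsReduced B)
    (h : ∀ x ∈ A.getLast?, ∀ y ∈ B.head?, x.1 = y.1 → x.2 = y.2) :
    FreeGroup.IsReduced (A ++ B) := List.isChain_append.2 ⟨hA, hB, h⟩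

/-- signed word of a letter image -/
def blk (p s : List A2) (m : A2 → List A2) (c : A2 × Bool) : List (A2 × Bool) :=
  if c.2 then pos (m c.1) ++ pos s else neg (m c.1) ++ neg p

theorem last_pos {T : List (A2 × Bool)} {w : List A2} (hw : w ≠ []) :
    (T ++ pos w).getLast? = w.getLast?.map fun x => (x, true) := by
  obtain ⟨u1, x, rfl⟩ := List.eq_nil_or_concat w |>.resolve_left hw
  simp [pos]
theorem last_neg {T : List (A2 × Bool)} {w : List A2} (hw : w ≠ []) :
    (T ++ neg w).getLast? = w.head?.map fun x => (x, false) := by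
  obtain ⟨x, u1, rfl⟩ := List.exists_cons_of_ne_nil hw
  simp [neg]
theorem head_pos {T : List (A2 × Bool)} {w : List A2} (hw : w ≠ []) :
    (pos w ++ T).head? = w.head?.map fun x => (x, true) := by
  obtain ⟨x, u1, rfl⟩ := List.exists_cons_of_ne_nil hw
  simp [pos]
theorem head_neg {T : List (A2 × Bool)} {w : List A2} (hw : w ≠ []) :
    (neg w ++ T).head? = w.getLast?.map fun x => (x, false) := by
  obtain ⟨u1, x, rfl⟩ := List.eq_nil_or_concat w |>.resolve_left hw
  simp [neg]

theorem syll {σ : Subst} {p s : List A2} {m : A2 → List A2}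
    (hm : ∀ c, σ c = p ++ m c ++ s) (hne : ∀ c, m c ≠ [])
    (hh : ∀ c d, c ≠ d → (m c).head? ≠ (m d).head?)
    (hl : ∀ c d, c ≠ d → (m c).getLast? ≠ (m d).getLast?)
    (l : List (A2 × Bool)) : ∀ c : A2 × Bool, FreeGroup.IsReduced (l ++ [c]) →
    ∃ T, endo σ (FreeGroup.mk (l ++ [c])) = FreeGroup.mk (T ++ blk p s m c) ∧
      FreeGroup.IsReduced (T ++ blk p s m c) ∧ l.length ≤ T.length := by
  have one : ∀ c : A2 × Bool, endo σ (FreeGroup.mk [c]) =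
      FreeGroup.mk ((if c.2 then pos p else neg s) ++ blk p s m c) := by
    rintro ⟨c, e⟩
    cases e
    · have : FreeGroup.mk [(c, false)] = (FreeGroup.of c)⁻¹ := rfl
      rw [this, map_inv, endo_of, hm]
      simp only [blk, Bool.false_eq_true, if_false, ← FreeGroup.mul_mk, mk_neg, toFG_append]
      group
    · have : FreeGroup.mk [(c, true)] = (FreeGroup.of c) := rfl
      rw [this, endo_of, hm]
      simp only [blk, if_true, ← FreeGroup.mul_mk, mk_pos, toFG_append]
      group
  induction l using List.reverseRecOn with
  | nil =>
    intro c _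
    refine ⟨_, by rw [List.nil_append]; exact one c, ?_, by simp⟩
    rcases c with ⟨c, _ | _⟩
    · simp only [blk, Bool.false_eq_true, if_false, ← neg_append]; exact isReduced_neg _
    · simp only [blk, if_true, ← pos_append]; exact isReduced_pos _
  | append_singleton l c ih =>
    intro d hd
    obtain ⟨T, h1, h2, h3⟩ := ih c (List.IsChain.left_of_append hd)
    have hcd : c.1 = d.1 → c.2 = d.2 := by
      have := (List.isChain_append.1 hd).2.2
      simpa using this
    have e : FreeGroup.mk (l ++ [c] ++ [d]) = FreeGroup.mk (l ++ [c]) * FreeGroup.mk [d] := by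
      rw [FreeGroup.mul_mk]
    rw [e, map_mul, h1, one]
    rcases c with ⟨c, e1⟩
    rcases d with ⟨d, e2⟩
    have hpos : 0 < (m c).length := List.length_pos_iff.2 (hne c)
    cases e1 <;> cases e2 <;>
      simp only [blk, if_true, Bool.false_eq_true, if_false, reduceCtorEq, imp_false] at *
    · refine ⟨T ++ neg (m c) ++ neg p ++ neg s, by simp [FreeGroup.mul_mk], ?_, ?_⟩
      · rw [List.append_assoc T, ← neg_append, List.append_assoc, List.append_assoc,
          ← neg_append, ← neg_append, ← neg_append]
        have hx : p ++ m d ++ s ++ (p ++ m c) = (p ++ m d ++ s ++ p) ++ m c := by simp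
        rw [hx, neg_append, ← List.append_assoc]
        refine red_app (h2.infix ⟨[], neg p, by simp⟩) (isReduced_neg _) ?_
        rw [last_neg (hne c)]
        intro x hx y hy _
        have hy' := List.mem_of_mem_head? hy
        simp only [Option.mem_def, Option.map_eq_some_iff] at hx
        obtain ⟨a, -, rfl⟩ := hx
        simp only [neg, List.mem_reverse, List.mem_map] at hy'
        obtain ⟨b, -, rfl⟩ := hy'
        rfl
      · simp [neg]; omega
    · refine ⟨T ++ neg (m c), ?_, ?_, ?_⟩
      · simp only [← FreeGroup.mul_mk, mk_neg, mk_pos]; group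
      · refine red_app (h2.infix ⟨[], neg p, by simp⟩)
          (by rw [← pos_append]; exact isReduced_pos _) ?_
        rw [last_neg (hne c), head_pos (hne d)]
        intro x hx y hy hxy
        simp only [Option.mem_def, Option.map_eq_some_iff] at hx hy
        obtain ⟨a, ha, rfl⟩ := hx
        obtain ⟨b, hb, rfl⟩ := hy
        simp only at hxy
        exact absurd (by rw [ha, hb, hxy]) (hh c d hcd)
      · simp [neg]; omega
    · refine ⟨T ++ pos (m c), ?_, ?_, ?_⟩
      · simp only [← FreeGroup.mul_mk, mk_neg, mk_pos]; group
      · refine red_app (h2.infix ⟨[], pos s, by simp⟩)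
          (by rw [← neg_append]; exact isReduced_neg _) ?_
        rw [last_pos (hne c), head_neg (hne d)]
        intro x hx y hy hxy
        simp only [Option.mem_def, Option.map_eq_some_iff] at hx hy
        obtain ⟨a, ha, rfl⟩ := hx
        obtain ⟨b, hb, rfl⟩ := hy
        simp only at hxy
        exact absurd (by rw [ha, hb, hxy]) (hl c d hcd)
      · simp [pos]; omega
    · refine ⟨T ++ pos (m c) ++ pos s ++ pos p, by simp [FreeGroup.mul_mk], ?_, ?_⟩
      · have hx : T ++ pos (m c) ++ pos s ++ pos p ++ (pos (m d) ++ pos s) =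
          (T ++ pos (m c)) ++ pos (s ++ p ++ m d ++ s) := by simp [pos_append]
        rw [hx]
        refine red_app (h2.infix ⟨[], pos s, by simp⟩) (isReduced_pos _) ?_
        rw [last_pos (hne c)]
        intro x hx y hy _
        have hy' := List.mem_of_mem_head? hy
        simp only [Option.mem_def, Option.map_eq_some_iff] at hx
        obtain ⟨a, -, rfl⟩ := hx
        simp only [pos, List.mem_map] at hy'
        obtain ⟨b, -, rfl⟩ := hy'
        rfl
      · simp [pos]; omega

theorem syll_letters {σ : Subst} {p s : List A2} {m : A2 → List A2}
    (hm : ∀ c, σ c = p ++ m c ++ s) (hne : ∀ c, m c ≠ [])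
    (hh : ∀ c d, c ≠ d → (m c).head? ≠ (m d).head?)
    (hl : ∀ c d, c ≠ d → (m c).getLast? ≠ (m d).getLast?)
    (hs : Function.Surjective (endo σ)) : ∀ c, (σ c).length = 1 := by
  have key : ∀ i : A2, ∃ c, σ c = [i] := by
    intro i
    obtain ⟨g, hg⟩ := hs (FreeGroup.of i)
    have hg0 : g.toWord ≠ [] := by
      intro h
      rw [FreeGroup.toWord_eq_nil_iff] at h
      rw [h, map_one] at hg
      exact FreeGroup.one_ne_of i hg
    obtain ⟨l, c, hlc⟩ := List.eq_nil_or_concat g.toWord |>.resolve_left hg0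
    have hred : FreeGroup.IsReduced g.toWord := FreeGroup.isReduced_toWord
    have hgl : g = FreeGroup.mk g.toWord := FreeGroup.mk_toWord.symm
    rw [hlc, List.concat_eq_append] at hred hgl
    obtain ⟨T, h1, h2, h3⟩ := syll hm hne hh hl l c hred
    rw [← hgl, hg] at h1
    have h4 := congrArg FreeGroup.toWord h1
    rw [FreeGroup.toWord_mk, h2.reduce_eq, FreeGroup.toWord_of] at h4
    have h5 := congrArg List.length h4
    have h6 : 0 < (m c.1).length := List.length_pos_iff.2 (hne c.1)
    have h7 : l = [] := by
      apply List.eq_nil_of_length_eq_zero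
      simp only [blk, List.length_append, List.length_singleton] at h5
      split_ifs at h5 <;> simp [pos, neg] at h5 <;> omega
    subst h7
    rcases c with ⟨c, _ | _⟩
    · exfalso
      simp only [blk, Bool.false_eq_true, if_false] at h4
      obtain ⟨x, u1, hx⟩ := List.exists_cons_of_ne_nil (hne c)
      have : (x, false) ∈ [(i, true)] := by rw [h4]; simp [neg, hx]
      simp at this
    · refine ⟨c, toFG_inj ?_⟩
      have : FreeGroup.mk [(c, true)] = (FreeGroup.of c) := rfl
      rw [← endo_of, toFG_single, ← this, ← hg, hgl]; rfl
  obtain ⟨c0, h0⟩ := key 0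
  obtain ⟨c1, h1⟩ := key 1
  have : c0 ≠ c1 := by rintro rfl; simp [h0] at h1
  intro c
  have : c = c0 ∨ c = c1 := two_cases this c
  rcases this with rfl | rfl
  · simp [h0]
  · simp [h1]

theorem reduction {σ : Subst} (h : IsInvertible σ) :
    (∀ c, (σ c).length = 1) ∨ ∃ (i j : A2) (p s w : List A2), i ≠ j ∧ σ i = p ++ s ∧
      σ j = p ++ w ++ s := by
  obtain ⟨p, u, v, s, h1, h2, h3⟩ := decomp _ (σ 0) (σ 1) le_rfl
  rcases h3 with rfl | rfl | ⟨a, b, c, d⟩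
  · exact Or.inr ⟨0, 1, p, s, v, by simp, by simpa using h1, h2⟩
  · exact Or.inr ⟨1, 0, p, s, u, by simp, by simpa using h2, h1⟩
  · left
    refine syll_letters (p := p) (s := s) (m := ![u, v]) ?_ ?_ ?_ ?_ h.2
    · intro c; fin_cases c <;> assumption
    · intro c; fin_cases c <;> assumption
    · intro c d hcd; fin_cases c <;> fin_cases d <;> simp_all [Ne.symm c]
    · intro c d hcd; fin_cases c <;> fin_cases d <;> simp_all
      exact fun h => d h.symm

/-- the elementary automorphism `j ↦ j i` -/
def elem (i j : A2) : Monoid.End (FreeGroup A2) :=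
  FreeGroup.lift fun k => if k = j then FreeGroup.of j * FreeGroup.of i else FreeGroup.of k

theorem elem_bij {i j : A2} (hij : i ≠ j) : Function.Bijective (elem i j) := by
  let e' : Monoid.End (FreeGroup A2) :=
    FreeGroup.lift fun k => if k = j then FreeGroup.of j * (FreeGroup.of i)⁻¹ else FreeGroup.of k
  have h1 : e'.comp (elem i j) = MonoidHom.id _ := by
    ext k
    by_cases hk : k = j <;> simp [e', elem, hk, hij]
  have h2 : (elem i j).comp e' = MonoidHom.id _ := by
    ext k
    by_cases hk : k = j <;> simp [e', elem, hk, hij]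
  exact Function.bijective_iff_has_inverse.2 ⟨e', fun x => DFunLike.congr_fun h1 x,
    fun x => DFunLike.congr_fun h2 x⟩

/-- the reduced substitution -/
def tau (i : A2) (p s w : List A2) : Subst := fun k => if k = i then s ++ p else w

theorem endo_tau {σ : Subst} {i j : A2} {p s w : List A2} (hij : i ≠ j) (hi : σ i = p ++ s)
    (hj : σ j = p ++ w ++ s) (x : FreeGroup A2) :
    endo σ x = toFG p * endo (tau i p s w) (elem i j x) * (toFG p)⁻¹ := by
  have : endo σ = (MulAut.conj (toFG p)).toMonoidHom.comp
      (MonoidHom.comp (endo (tau i p s w)) (elem i j)) := by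
    apply FreeGroup.ext_hom
    intro k
    change endo σ (FreeGroup.of k) =
      toFG p * endo (tau i p s w) (elem i j (FreeGroup.of k)) * (toFG p)⁻¹
    rw [endo_of]
    have hk : k = i ∨ k = j := two_cases hij k
    rcases hk with rfl | rfl
    · have : elem k j (FreeGroup.of k) = FreeGroup.of k :=
        FreeGroup.lift_apply_of.trans (if_neg hij)
      rw [this, endo_of, hi]
      simp [tau, toFG_append, mul_assoc]
    · have : elem i k (FreeGroup.of k) = FreeGroup.of k * FreeGroup.of i :=
        FreeGroup.lift_apply_of.trans (if_pos rfl)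
      rw [this, map_mul, endo_of, endo_of, hj]
      simp [tau, toFG_append, hij.symm, mul_assoc]
  rw [this]; rfl

theorem inv_tau {σ : Subst} {i j : A2} {p s w : List A2} (hij : i ≠ j) (hi : σ i = p ++ s)
    (hj : σ j = p ++ w ++ s) (h : IsInvertible σ) : IsInvertible (tau i p s w) := by
  have e : endo σ = ⇑(MulAut.conj (toFG p)) ∘ (⇑(endo (tau i p s w)) ∘ ⇑(elem i j)) := by
    funext x; rw [endo_tau hij hi hj]; simp
  unfold IsInvertible at *
  rw [e, Function.Bijective.of_comp_iff' (MulEquiv.bijective _),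
    Function.Bijective.of_comp_iff _ (elem_bij hij)] at h
  exact h

theorem image_ne_nil {σ : Subst} (h : IsInvertible σ) (i : A2) : σ i ≠ [] := by
  intro h0
  have : endo σ (FreeGroup.of i) = endo σ 1 := by rw [endo_of, h0, map_one]; rfl
  exact FreeGroup.of_ne_one i (h.1 this)

theorem image_ne {σ : Subst} (h : IsInvertible σ) {i j : A2} (hij : i ≠ j) : σ i ≠ σ j := by
  intro h0
  have : endo σ (FreeGroup.of i) = endo σ (FreeGroup.of j) := by rw [endo_of, h0, endo_of]
  exact hij (FreeGroup.of_injective (h.1 this))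

theorem length_count (w : List A2) : w.length = w.count 0 + w.count 1 := by
  induction w with
  | nil => simp
  | cons x w ih => fin_cases x <;> simp [ih] <;> omega

theorem count_eq_length {v w : List A2} (h : ∀ k, v.count k = w.count k) :
    v.length = w.length := by
  rw [length_count, length_count, h, h]

theorem conj_of_count (n : ℕ) : ∀ σ ρ : Subst, (σ 0).length + (σ 1).length ≤ n →
    IsInvertible σ → IsInvertible ρ → (∀ i k, (σ i).count k = (ρ i).count k) → Conj σ ρ := by
  induction n with
  | zero =>
    intro σ ρ hn hσ
    exact absurd (List.eq_nil_of_length_eq_zero (by omega)) (image_ne_nil hσ 0)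
  | succ n ih =>
    intro σ ρ hn hσ hρ hc
    have hlen : ∀ i, (σ i).length = (ρ i).length := fun i => count_eq_length (hc i)
    have letters : (∀ c, (σ c).length = 1) → Conj σ ρ := by
      intro h1
      have : σ = ρ := by
        funext c
        obtain ⟨x, hx⟩ := List.length_eq_one_iff.1 (h1 c)
        obtain ⟨y, hy⟩ := List.length_eq_one_iff.1 ((hlen c).symm.trans (h1 c))
        have := hc c x
        rw [hx, hy] at this ⊢
        simp [List.count_singleton] at this
        rw [this]
      subst this
      exact ⟨1, by simp⟩
    rcases reduction hσ with h1 | ⟨i, j, p, s, w, hij, hi, hj⟩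
    · exact letters h1
    rcases reduction hρ with h1 | ⟨i', j', p', s', w', hij', hi', hj'⟩
    · exact letters fun c => (hlen c).trans (h1 c)
    by_cases hii : i = i'
    · subst hii
      obtain rfl : j = j' := ((two_cases hij j').resolve_left hij'.symm).symm
      have hw : ∀ k, w.count k = w'.count k := by
        intro k
        have a1 := hc i k
        have a2 := hc j k
        rw [hi, hi'] at a1
        rw [hj, hj'] at a2
        simp only [List.count_append] at a1 a2
        omega
      obtain ⟨W, hW⟩ := ih (tau i p s w) (tau i p' s' w') (by
          have hlt : (tau i p s w i).length + (tau i p s w j).length ≤ n := by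
            have hs : (σ i).length + (σ j).length ≤ n + 1 := by
              fin_cases i <;> fin_cases j <;> simp_all <;> omega
            have hp := List.length_pos_iff.2 (image_ne_nil hσ i)
            rw [hi, hj] at hs
            rw [hi] at hp
            simp only [tau, if_true, hij.symm, if_false, List.length_append] at *
            omega
          revert hlt
          generalize tau i p s w = t
          fin_cases i <;> fin_cases j <;> simp_all <;> omega)
        (inv_tau hij hi hj hσ) (inv_tau hij hi' hj' hρ) (by
          intro l k
          have a1 := hc i k
          rw [hi, hi'] at a1
          simp only [List.count_append] at a1
          unfold tau
          split_ifs
          · simp only [List.count_append]; omega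
          · exact hw k)
      refine ⟨toFG p * W * (toFG p')⁻¹, fun x => ?_⟩
      rw [endo_tau hij hi hj, endo_tau hij hi' hj', hW]
      group
    · obtain rfl : i' = j := (two_cases hij i').resolve_left (Ne.symm hii)
      obtain rfl : j' = i := (two_cases hij j').resolve_right hij'.symm
      exfalso
      have hw : w = [] := by
        have a1 := hlen i'
        have a2 := hlen j'
        rw [hi, hj'] at a2
        rw [hj, hi'] at a1
        simp only [List.length_append] at a1 a2
        apply List.eq_nil_of_length_eq_zero
        omega
      subst hw
      apply image_ne hσ hij
      rw [hi, hj]; simp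

theorem conj_of_M {σ ρ : Subst} (hσ : IsInvertible σ) (hρ : IsInvertible ρ) (h : M σ = M ρ) :
    Conj σ ρ := by
  refine conj_of_count _ σ ρ le_rfl hσ hρ fun i k => ?_
  have := congrFun (congrFun h k) i
  simpa [M] using this

/-! abelianisation -/
theorem expSum_toFG (i : A2) (w : List A2) :
    Multiplicative.toAdd (expSum i (toFG w)) = (w.count i : ℤ) := by
  induction w with
  | nil => simp [toFG_nil]
  | cons x w ih =>
    rw [toFG_cons, map_mul, toAdd_mul, ih, List.count_cons]
    simp only [expSum, FreeGroup.lift_apply_of, toAdd_ofAdd, beq_iff_eq]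
    push_cast
    split_ifs <;> ring

theorem M_of_conj {σ ρ : Subst} (h : Conj σ ρ) : M σ = M ρ := by
  obtain ⟨w, hw⟩ := h
  ext i j
  have := congrArg (fun g => Multiplicative.toAdd (expSum i g)) (hw (FreeGroup.of j))
  simp only [endo_of, map_mul, map_inv, mul_inv_cancel_comm, expSum_toFG] at this
  exact this

theorem exp_endo (σ : Subst) (i : A2) (g : FreeGroup A2) :
    Multiplicative.toAdd (expSum i (endo σ g)) =
      ((M σ).mulVec fun k => Multiplicative.toAdd (expSum k g)) i := by
  induction g using FreeGroup.induction_on with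
  | C1 => simp [Matrix.mulVec, dotProduct]
  | of x => 
    rw [endo_of, expSum_toFG]
    simp only [expSum, FreeGroup.lift_apply_of, toAdd_ofAdd, Matrix.mulVec, dotProduct, M]
    simp
  | inv_of x h =>
    rw [map_inv, map_inv, toAdd_inv, h]
    simp [Matrix.mulVec, dotProduct]
  | mul x y hx hy =>
    rw [map_mul, map_mul, toAdd_mul, hx, hy]
    simp [Matrix.mulVec, dotProduct]; ring

theorem M_inv {σ : Subst} (h : IsInvertible σ) : ∃ N, N * M σ = 1 := by
  choose g hg using fun j : A2 => h.2 (FreeGroup.of j)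
  refine ⟨Matrix.of fun k j => Multiplicative.toAdd (expSum k (g j)), ?_⟩
  rw [mul_eq_one_comm]
  ext i j
  have := exp_endo σ i (g j)
  rw [hg] at this
  rw [Matrix.mul_apply]
  simp only [Matrix.mulVec, dotProduct] at this
  simp only [Matrix.of_apply]
  rw [← this]
  simp only [expSum, FreeGroup.lift_apply_of, toAdd_ofAdd, Matrix.one_apply]
  simp [eq_comm]

end TwoSubst
namespace TwoSubst

theorem mulVec_two (σ : Subst) (v : Fin 2 → ℝ) (lam : ℝ) (h : (Mreal σ).mulVec v = lam • v) :
    ((M σ 0 0 : ℝ) * v 0 + (M σ 0 1 : ℝ) * v 1 = lam * v 0) ∧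
    ((M σ 1 0 : ℝ) * v 0 + (M σ 1 1 : ℝ) * v 1 = lam * v 1) := by
  have h0 := congrFun h 0
  have h1 := congrFun h 1
  simpa [Matrix.mulVec, dotProduct, Fin.sum_univ_two, Mreal] using And.intro h0 h1

theorem M_nonneg (σ : Subst) (i j : A2) : (0 : ℝ) ≤ (M σ i j : ℝ) := by
  simp [M]

theorem lam_unique (σ : Subst) (v w : Fin 2 → ℝ) (lam mu : ℝ) (hv : ∀ i, 0 < v i)
    (hw : ∀ i, 0 < w i) (h : (Mreal σ).mulVec v = lam • v) (h' : (Mreal σ).mulVec w = mu • w) :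
    lam = mu := by
  obtain ⟨a1, a2⟩ := mulVec_two σ v lam h
  obtain ⟨b1, b2⟩ := mulVec_two σ w mu h'
  have n1 := M_nonneg σ 0 1
  have n2 := M_nonneg σ 1 0
  have e1 : (lam - mu) * (v 0 * w 0) = (M σ 0 1 : ℝ) * (v 1 * w 0 - w 1 * v 0) := by
    linear_combination (-w 0) * a1 + v 0 * b1
  have e2 : (lam - mu) * (v 1 * w 1) = (M σ 1 0 : ℝ) * (-(v 1 * w 0 - w 1 * v 0)) := by
    linear_combination (-w 1) * a2 + v 1 * b2
  have p1 := mul_pos (hv 0) (hw 0)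
  have p2 := mul_pos (hv 1) (hw 1)
  generalize v 1 * w 0 - w 1 * v 0 = d at *
  rcases le_total 0 d with hd | hd
  · have h1 : 0 ≤ (lam - mu) * (v 0 * w 0) := by rw [e1]; positivity
    have h2 : (lam - mu) * (v 1 * w 1) ≤ 0 := by
      rw [e2]; exact mul_nonpos_of_nonneg_of_nonpos n2 (by linarith)
    have := nonneg_of_mul_nonneg_left h1 p1
    have := nonpos_of_mul_nonpos_left h2 p2
    linarith
  · have h1 : (lam - mu) * (v 0 * w 0) ≤ 0 := by
      rw [e1]; exact mul_nonpos_of_nonneg_of_nonpos n1 hd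
    have h2 : 0 ≤ (lam - mu) * (v 1 * w 1) := by
      rw [e2]; exact mul_nonneg n2 (by linarith)
    have := nonneg_of_mul_nonneg_left h2 p2
    have := nonpos_of_mul_nonpos_left h1 p1
    linarith

/-- no positive integer eigenvector directions -/
theorem no_int {σ : Subst} (hσ : Primitive σ) (hi : IsInvertible σ) (p q : ℤ) (hp : 0 < p)
    (hq : 0 < q) (hpq : IsCoprime p q)
    (h : q * (M σ 0 0 * p + M σ 0 1 * q) = p * (M σ 1 0 * p + M σ 1 1 * q)) : False := by
  obtain ⟨N, hN⟩ := M_inv hi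
  obtain ⟨k, hk⟩ : p ∣ (M σ 0 0 * p + M σ 0 1 * q) :=
    hpq.dvd_of_dvd_mul_left ⟨_, h⟩
  have hk2 : M σ 1 0 * p + M σ 1 1 * q = q * k := by
    rw [hk] at h
    have := mul_left_cancel₀ hp.ne' (show p * (q * k) = p * (M σ 1 0 * p + M σ 1 1 * q) by
      linarith)
    exact this.symm
  have hMu : (M σ).mulVec ![p, q] = k • ![p, q] := by
    ext i
    fin_cases i
    · simp [Matrix.mulVec, dotProduct, Fin.sum_univ_two]; linarith
    · simp [Matrix.mulVec, dotProduct, Fin.sum_univ_two]; linarith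
  have hu : ![p, q] = k • N.mulVec ![p, q] := by
    rw [← Matrix.mulVec_smul, ← hMu, Matrix.mulVec_mulVec, hN, Matrix.one_mulVec]
  have d1 : k ∣ p := ⟨N.mulVec ![p, q] 0, by simpa using congrFun hu 0⟩
  have d2 : k ∣ q := ⟨N.mulVec ![p, q] 1, by simpa using congrFun hu 1⟩
  have hu' : IsUnit k := hpq.isUnit_of_dvd' d1 d2
  have hk0 : 0 ≤ k := by
    have h0 : 0 ≤ M σ 0 0 * p + M σ 0 1 * q := by
      have : 0 ≤ M σ 0 0 := by simp [M]
      have : 0 ≤ M σ 0 1 := by simp [M]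
      positivity
    rw [hk] at h0
    exact nonneg_of_mul_nonneg_right h0 hp
  have hk1 : k = 1 := by
    rcases Int.isUnit_iff.1 hu' with h | h <;> omega
  rw [hk1, one_smul] at hMu
  obtain ⟨n, -, hn⟩ := hσ
  have hpow : ∀ n, (M σ ^ n).mulVec ![p, q] = ![p, q] := by
    intro n
    induction n with
    | zero => simp
    | succ n ih => rw [pow_succ, ← Matrix.mulVec_mulVec, hMu, ih]
  have := congrFun (hpow n) 0
  simp [Matrix.mulVec, dotProduct, Fin.sum_univ_two] at this
  have h1 := hn 0 0
  have h2 := hn 0 1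
  nlinarith

theorem int_dir (a b : ℤ) (hab : a ≠ 0 ∨ b ≠ 0) (v0 v1 : ℝ) (h0 : 0 < v0) (h1 : 0 < v1)
    (h : (a : ℝ) * v0 + b * v1 = 0) :
    ∃ (p q : ℤ) (c : ℝ), 0 < p ∧ 0 < q ∧ IsCoprime p q ∧ 0 < c ∧ v0 = c * p ∧ v1 = c * q := by
  have hb : b ≠ 0 := by
    rintro rfl
    simp at h
    rcases h with h | h
    · simp_all
    · linarith
  have ha : a ≠ 0 := by
    rintro rfl
    simp at h
    rcases h with h | h
    · exact hb h
    · linarith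
  have habs : |(a : ℝ)| * v0 = |(b : ℝ)| * v1 := by
    have : (a : ℝ) * v0 = - (b * v1) := by linarith
    have := congrArg abs this
    rwa [abs_neg, abs_mul, abs_mul, abs_of_pos h0, abs_of_pos h1] at this
  have hg : 0 < (Int.gcd a b : ℤ) := by
    exact_mod_cast Int.gcd_pos_of_ne_zero_left b ha
  obtain ⟨p, hp⟩ : (Int.gcd a b : ℤ) ∣ |b| := (dvd_abs _ _).2 (Int.gcd_dvd_right ..)
  obtain ⟨q, hq⟩ : (Int.gcd a b : ℤ) ∣ |a| := (dvd_abs _ _).2 (Int.gcd_dvd_left ..)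
  have pp : 0 < p := by
    have : 0 < |b| := abs_pos.2 hb
    rw [hp] at this
    exact pos_of_mul_pos_right this hg.le
  have qq : 0 < q := by
    have : 0 < |a| := abs_pos.2 ha
    rw [hq] at this
    exact pos_of_mul_pos_right this hg.le
  have pr : (0 : ℝ) < p := by exact_mod_cast pp
  have qr : (0 : ℝ) < q := by exact_mod_cast qq
  refine ⟨p, q, v0 / p, pp, qq, ?_, by positivity, by field_simp, ?_⟩
  · have := Int.gcd_eq_gcd_ab |a| |b|
    have hgg : Int.gcd |a| |b| = Int.gcd a b := by simp [Int.gcd, Int.natAbs_abs]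
    rw [hgg] at this
    refine ⟨Int.gcdB |a| |b|, Int.gcdA |a| |b|, ?_⟩
    apply mul_left_cancel₀ hg.ne'
    generalize Int.gcdA |a| |b| = x at *
    generalize Int.gcdB |a| |b| = y at *
    rw [mul_one]
    linear_combination -this - x * hq - y * hp
  · have hp' : |(b : ℝ)| = (Int.gcd a b : ℤ) * p := by exact_mod_cast hp
    have hq' : |(a : ℝ)| = (Int.gcd a b : ℤ) * q := by exact_mod_cast hq
    rw [hp', hq'] at habs
    have hgr : (0 : ℝ) < (Int.gcd a b : ℤ) := by exact_mod_cast hg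
    have : (q : ℝ) * v0 = p * v1 := by
      apply mul_left_cancel₀ hgr.ne'
      linarith
    field_simp
    linarith

theorem M_eq {σ ρ : Subst} (hσ : Primitive σ) (hi : IsInvertible σ) (v : Fin 2 → ℝ)
    (hv : ∀ i, 0 < v i) (lam : ℝ) (h : (Mreal σ).mulVec v = lam • v)
    (h' : (Mreal ρ).mulVec v = lam • v) : M σ = M ρ := by
  obtain ⟨a1, a2⟩ := mulVec_two σ v lam h
  obtain ⟨b1, b2⟩ := mulVec_two ρ v lam h'
  have key : ∀ a b : ℤ, (a : ℝ) * v 0 + b * v 1 = 0 → a = 0 ∧ b = 0 := by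
    intro a b hab
    by_contra hne
    obtain ⟨p, q, c, hp, hq, hpq, hc, e0, e1⟩ :=
      int_dir a b (by tauto) (v 0) (v 1) (hv 0) (hv 1) hab
    refine no_int hσ hi p q hp hq hpq ?_
    rw [e0, e1] at a1 a2
    have f1 : (M σ 0 0 : ℝ) * p + (M σ 0 1 : ℝ) * q = lam * p := by
      apply mul_left_cancel₀ hc.ne'; linarith
    have f2 : (M σ 1 0 : ℝ) * p + (M σ 1 1 : ℝ) * q = lam * q := by
      apply mul_left_cancel₀ hc.ne'; linarith
    have : (q : ℝ) * (M σ 0 0 * p + M σ 0 1 * q) = p * (M σ 1 0 * p + M σ 1 1 * q) := by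
      rw [f1, f2]; ring
    exact_mod_cast this
  obtain ⟨c1, c2⟩ := key (M σ 0 0 - M ρ 0 0) (M σ 0 1 - M ρ 0 1) (by push_cast; linarith)
  obtain ⟨c3, c4⟩ := key (M σ 1 0 - M ρ 1 0) (M σ 1 1 - M ρ 1 1) (by push_cast; linarith)
  ext i j
  fin_cases i <;> fin_cases j <;> simp <;> omega

theorem freq_pos {α : ℝ} (h0 : 0 < α) (h1 : α < 1) : ∀ i, 0 < ![1 - α, α] i := by
  intro i; fin_cases i <;> simp <;> linarith

theorem conj_of_freq {σ ρ : Subst} (hσ : Primitive σ) (hiσ : IsInvertible σ)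
    (hiρ : IsInvertible ρ) (hlam : ∃ lam : ℝ, IsInflation σ lam ∧ IsInflation ρ lam)
    (h : ∃ α : ℝ, IsFreq σ α ∧ IsFreq ρ α) : Conj σ ρ := by
  obtain ⟨lam, ⟨v, hv, hv'⟩, ⟨w, hw, hw'⟩⟩ := hlam
  obtain ⟨α, ⟨h0, h1, l1, e1⟩, ⟨-, -, l2, e2⟩⟩ := h
  have hp := freq_pos h0 h1
  have E1 := lam_unique σ _ _ _ _ hv hp hv' e1
  have E2 := lam_unique ρ _ _ _ _ hw hp hw' e2
  subst E1
  subst E2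
  exact conj_of_M hiσ hiρ (M_eq hσ hiσ _ hp _ e1 e2)

theorem exists_freq {σ : Subst} {lam : ℝ} (h : IsInflation σ lam) :
    ∃ α, 0 < α ∧ α < 1 ∧ (Mreal σ).mulVec ![1 - α, α] = lam • ![1 - α, α] := by
  obtain ⟨v, hv, hv'⟩ := h
  have h0 := hv 0
  have h1 := hv 1
  refine ⟨v 1 / (v 0 + v 1), by positivity, by rw [div_lt_one] <;> linarith, ?_⟩
  have : ![1 - v 1 / (v 0 + v 1), v 1 / (v 0 + v 1)] = (v 0 + v 1)⁻¹ • v := by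
    ext i
    fin_cases i <;> simp <;> field_simp
    ring
  rw [this, Matrix.mulVec_smul, hv', smul_comm]

/-! bounded discrepancy -/
/-- discrepancy functional -/
noncomputable def disc (α : ℝ) (w : List A2) : ℝ := α * w.count 0 - (1 - α) * w.count 1

theorem disc_append (α : ℝ) (v w : List A2) : disc α (v ++ w) = disc α v + disc α w := by
  simp [disc]; ring

theorem lam_gt_one {σ : Subst} (hσ : Primitive σ) {lam : ℝ} {v : Fin 2 → ℝ} (hv : ∀ i, 0 < v i)
    (h : (Mreal σ).mulVec v = lam • v) : 1 < lam := by
  obtain ⟨n, hn0, hn⟩ := hσ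
  have hpow : ∀ n, (Mreal σ ^ n).mulVec v = lam ^ n • v := by
    intro n
    induction n with
    | zero => simp
    | succ n ih =>
      rw [pow_succ, ← Matrix.mulVec_mulVec, h, Matrix.mulVec_smul, ih, smul_smul, pow_succ']
  have hM : ∀ i j, (1 : ℝ) ≤ (Mreal σ ^ n) i j := by
    intro i j
    have : Mreal σ ^ n = (M σ ^ n).map fun z => (z : ℝ) := by
      exact (Matrix.map_pow (M σ) (Int.castRingHom ℝ) n).symm
    rw [this, Matrix.map_apply]
    exact_mod_cast hn i j
  have h0 := congrFun (hpow n) 0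
  simp only [Matrix.mulVec, dotProduct, Fin.sum_univ_two, Pi.smul_apply, smul_eq_mul] at h0
  have h1 := hM 0 0
  have h2 := hM 0 1
  have v0 := hv 0
  have v1 := hv 1
  have hl : 1 < lam ^ n := by
    by_contra hl
    push Not at hl
    nlinarith
  have hl0 : 0 ≤ lam := by
    obtain ⟨a1, -⟩ := mulVec_two σ v lam h
    have n1 := M_nonneg σ 0 0
    have n2 := M_nonneg σ 0 1
    have : 0 ≤ lam * v 0 := by rw [← a1]; positivity
    exact nonneg_of_mul_nonneg_left this v0
  by_contra hl1
  push Not at hl1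
  exact absurd (pow_le_one₀ hl0 hl1) (not_le.2 hl)

theorem det_abs {σ : Subst} (h : IsInvertible σ) : |M σ 0 0 * M σ 1 1 - M σ 0 1 * M σ 1 0| = 1 := by
  obtain ⟨N, hN⟩ := M_inv h
  have := congrArg Matrix.det hN
  rw [Matrix.det_mul, Matrix.det_one, Matrix.det_fin_two (M σ)] at this
  exact Int.isUnit_iff_abs_eq.1 (IsUnit.of_mul_eq_one_right _ this)

theorem disc_apply {σ : Subst} (hi : IsInvertible σ) {lam α : ℝ} (hl : 1 < lam)
    (h : (Mreal σ).mulVec ![1 - α, α] = lam • ![1 - α, α]) (w : List A2) :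
    |disc α (apply σ w)| = |disc α w| / lam := by
  obtain ⟨a1, a2⟩ := mulVec_two σ _ lam h
  simp only [Matrix.cons_val_zero, Matrix.cons_val_one] at a1 a2
  have c0 := congrFun (Avec_apply σ w) 0
  have c1 := congrFun (Avec_apply σ w) 1
  simp only [Avec, Matrix.mulVec, dotProduct, Fin.sum_univ_two] at c0 c1
  have c0' : ((apply σ w).count 0 : ℝ) = M σ 0 0 * w.count 0 + M σ 0 1 * w.count 1 := by
    exact_mod_cast c0
  have c1' : ((apply σ w).count 1 : ℝ) = M σ 1 0 * w.count 0 + M σ 1 1 * w.count 1 := by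
    exact_mod_cast c1
  have hd : |(M σ 0 0 * M σ 1 1 - M σ 0 1 * M σ 1 0 : ℝ)| = 1 := by exact_mod_cast det_abs hi
  have hl0 : 0 < lam := by linarith
  have key : lam * disc α (apply σ w) =
      (M σ 0 0 * M σ 1 1 - M σ 0 1 * M σ 1 0) * disc α w := by
    unfold disc
    rw [c0', c1']
    generalize (w.count 0 : ℝ) = x
    generalize (w.count 1 : ℝ) = y
    linear_combination -(M σ 0 0 * x + M σ 0 1 * y) * a2 + (M σ 1 0 * x + M σ 1 1 * y) * a1
  have := congrArg abs key
  rw [abs_mul, abs_mul, hd, abs_of_pos hl0, one_mul] at this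
  rw [eq_div_iff hl0.ne', ← this]; ring

theorem prefix_apply (σ : Subst) (w : List A2) : ∀ q : List A2, q <+: apply σ w → q ≠ [] →
    ∃ w' x q', w' <+: w ∧ q' <+: σ x ∧ q = apply σ w' ++ q' := by
  induction w with
  | nil => intro q hq h0; simp [apply_nil] at hq; exact absurd hq h0
  | cons x w ih =>
    intro q hq h0
    rw [apply_cons] at hq
    have hcase : q <+: σ x ∨ ∃ t, q = σ x ++ t ∧ t <+: apply σ w := by
      rcases List.prefix_or_prefix_of_prefix hq (List.prefix_append (σ x) (apply σ w)) with h | ⟨t, ht⟩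
      · exact Or.inl h
      · refine Or.inr ⟨t, ht.symm, ?_⟩
        rw [← ht] at hq
        exact (List.prefix_append_right_inj _).1 hq
    rcases hcase with h | ⟨t, rfl, ht⟩
    · exact ⟨[], x, q, by simp, h, by simp [apply_nil]⟩
    · by_cases ht0 : t = []
      · subst ht0
        exact ⟨[], x, σ x, by simp, by simp, by simp [apply_nil]⟩
      obtain ⟨w', y, q', h1, h2, h3⟩ := ih t ht ht0
      exact ⟨x :: w', y, q', by simpa using h1, h2, by rw [apply_cons, h3]; simp⟩

theorem disc_le (α : ℝ) (h0 : 0 < α) (h1 : α < 1) (w : List A2) : |disc α w| ≤ w.length := by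
  rw [length_count, disc, abs_le]
  push_cast
  have : (0 : ℝ) ≤ w.count 0 := by positivity
  have : (0 : ℝ) ≤ w.count 1 := by positivity
  constructor <;> nlinarith

theorem disc_bound {σ : Subst} (hσ : Primitive σ) (hi : IsInvertible σ) {lam α : ℝ}
    (h0 : 0 < α) (h1 : α < 1)
    (h : (Mreal σ).mulVec ![1 - α, α] = lam • ![1 - α, α]) :
    ∃ C : ℝ, ∀ n x w, w <:+: substPow σ n x → |disc α w| ≤ C := by
  have hl := lam_gt_one hσ (freq_pos h0 h1) h
  have hl0 : 0 < lam := by linarith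
  set B : ℝ := (σ 0).length + (σ 1).length + 1 with hB
  set C : ℝ := B * lam / (lam - 1) with hC
  have hBp : 1 ≤ B := by rw [hB]; have : (0 : ℝ) ≤ (σ 0).length + (σ 1).length := by positivity
                         linarith
  have hlm : 0 < lam - 1 := by linarith
  have hCB : C / lam + B = C := by rw [hC]; field_simp; ring
  have hC0 : 0 ≤ C := by rw [hC]; positivity
  have hBC : B ≤ C := by
    have : 0 ≤ C / lam := by positivity
    linarith
  have hx : ∀ x q, q <+: σ x → |disc α q| ≤ B := by
    intro x q hq
    have := disc_le α h0 h1 q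
    have hle : (q.length : ℝ) ≤ (σ x).length := by exact_mod_cast hq.length_le
    have : ((σ x).length : ℝ) ≤ B := by
      have p0 : (0 : ℝ) ≤ (σ 0).length := by positivity
      have p1 : (0 : ℝ) ≤ (σ 1).length := by positivity
      rw [hB]
      rcases two_cases (i := 0) (j := 1) (by simp) x with rfl | rfl <;> linarith
    linarith
  have pre : ∀ n x q, q <+: substPow σ n x → |disc α q| ≤ C := by
    intro n
    induction n with
    | zero =>
      intro x q hq
      have := disc_le α h0 h1 q
      have hle : (q.length : ℝ) ≤ 1 := by
        have := hq.length_le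
        simp [substPow] at this
        exact_mod_cast this
      linarith
    | succ n ih =>
      intro x q hq
      by_cases hq0 : q = []
      · subst hq0; simpa [disc] using hC0
      unfold substPow at hq
      rw [Function.iterate_succ_apply'] at hq
      obtain ⟨w', y, q', e1, e2, rfl⟩ := prefix_apply σ _ q hq hq0
      rw [disc_append]
      have t1 := ih x w' e1
      have t2 := hx y q' e2
      have t3 := disc_apply hi hl h w'
      have t4 : |disc α w'| / lam ≤ C / lam := by gcongr
      have := abs_add_le (disc α (apply σ w')) (disc α q')
      linarith
  refine ⟨2 * C, fun n x w ⟨s, t, hst⟩ => ?_⟩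
  have t1 := pre n x (s ++ w) ⟨t, hst⟩
  have t2 := pre n x s ⟨w ++ t, by simpa using hst⟩
  rw [disc_append] at t1
  rw [abs_le] at *
  constructor <;> linarith

theorem hull_nonempty {σ : Subst} (hσ : Primitive σ) : (Hull σ).Nonempty := by
  obtain ⟨k, hk⟩ := exists_mem_iter hσ
  let W : ℕ → List A2 := fun n => (apply σ)^[k * (2 * n)] [0]
  have hW : ∀ n, 2 * n ≤ (W n).length := fun n => length_grow hk (2 * n) [0] (by simp)
  let U : ℕ → ℤ → A2 := fun n z => (W n).getD (z + n).toNat 0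
  have hex : ∀ z : ℤ, ∃ x : A2, ∀ᶠ n in (Filter.hyperfilter ℕ : Filter ℕ), U n z = x := by
    intro z
    have : ∀ᶠ n in (Filter.hyperfilter ℕ : Filter ℕ), U n z = 0 ∨ U n z = 1 :=
      Filter.Eventually.of_forall fun n => two_cases (by simp) _
    rw [Ultrafilter.eventually_or] at this
    rcases this with h | h
    · exact ⟨0, h⟩
    · exact ⟨1, h⟩
  choose u hu using hex
  refine ⟨u, fun w ⟨z, hz⟩ => ?_⟩
  have e1 : ∀ᶠ n in (Filter.hyperfilter ℕ : Filter ℕ), ∀ i ∈ Finset.range w.length,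
      U n (z + i) = u (z + i) := by
    rw [Filter.eventually_all_finset]
    exact fun i _ => hu _
  have e2 : ∀ᶠ n in (Filter.hyperfilter ℕ : Filter ℕ), z.natAbs + w.length ≤ n := by
    apply Filter.Eventually.filter_mono (Nat.hyperfilter_le_atTop)
    exact Filter.eventually_ge_atTop _
  obtain ⟨n, h1, h2⟩ := (e1.and e2).exists
  refine ⟨k * (2 * n), 0, ?_⟩
  change w <:+: W n
  have hlen := hW n
  obtain ⟨m, hm⟩ : ∃ m : ℕ, z + n = m := ⟨(z + n).toNat, by omega⟩
  have hml : m + w.length ≤ (W n).length := by omega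
  have : w = ((W n).drop m).take w.length := by
    apply List.ext_getElem
    · simp; omega
    · intro i hi hi'
      have a : w[i] = u (z + i) := by
        have := congrArg (fun l => l[i]?) hz
        simp only [List.pure_def, List.bind_eq_flatMap, ← List.map_eq_flatMap, List.map_map,
          List.getElem?_map, List.getElem?_range hi, List.getElem?_eq_getElem hi] at this
        simpa using this
      rw [a, ← h1 i (by simpa using hi)]
      have e3 : (z + i + n).toNat = m + i := by omega
      simp only [U, e3, List.getElem_take, List.getElem_drop]
      rw [List.getD_eq_getElem]
  rw [this]
  exact (List.take_prefix _ _).isInfix.trans (List.drop_suffix _ _).isInfix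

theorem freq_of_hull {σ ρ : Subst} (hσ : Primitive σ) (hρ : Primitive ρ) (hiσ : IsInvertible σ)
    (hiρ : IsInvertible ρ) (hlam : ∃ lam : ℝ, IsInflation σ lam ∧ IsInflation ρ lam)
    (h : Hull σ = Hull ρ) : ∃ α : ℝ, IsFreq σ α ∧ IsFreq ρ α := by
  obtain ⟨lam, hs, hr⟩ := hlam
  obtain ⟨α, a0, a1, ha⟩ := exists_freq hs
  obtain ⟨β, b0, b1, hb⟩ := exists_freq hr
  obtain ⟨C, hC⟩ := disc_bound hσ hiσ a0 a1 ha
  obtain ⟨D, hD⟩ := disc_bound hρ hiρ b0 b1 hb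
  obtain ⟨u, hu⟩ := hull_nonempty hσ
  have hu' : u ∈ Hull ρ := h ▸ hu
  have key : ∀ N : ℕ, |α - β| * N ≤ C + D := by
    intro N
    let w : List A2 := (List.range N).map fun i => u (0 + i)
    have hwl : w.length = N := by simp [w]
    have hw : IsFactor w u := ⟨0, by rw [hwl]⟩
    obtain ⟨n, x, h1⟩ := hu w hw
    obtain ⟨m, y, h2⟩ := hu' w hw
    have c1 := hC n x w h1
    have c2 := hD m y w h2
    have e : (α - β) * N = disc α w - disc β w := by
      rw [← hwl, length_count]; unfold disc; push_cast; ring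
    have := congrArg abs e
    rw [abs_mul, Nat.abs_cast] at this
    rw [this]
    exact (abs_sub _ _).trans (add_le_add c1 c2)
  have : α = β := by
    by_contra hne
    have hp : 0 < |α - β| := abs_pos.2 (sub_ne_zero.2 hne)
    obtain ⟨N, hN⟩ := exists_nat_gt ((C + D) / |α - β|)
    rw [div_lt_iff₀ hp] at hN
    have := key N
    linarith
  subst this
  exact ⟨α, ⟨a0, a1, lam, ha⟩, ⟨b0, b1, lam, hb⟩⟩

theorem freq_of_conj {σ ρ : Subst} (hlam : ∃ lam : ℝ, IsInflation σ lam ∧ IsInflation ρ lam)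
    (h : Conj σ ρ) : ∃ α : ℝ, IsFreq σ α ∧ IsFreq ρ α := by
  obtain ⟨lam, hs, hr⟩ := hlam
  obtain ⟨α, a0, a1, ha⟩ := exists_freq hs
  have ha' := ha
  unfold Mreal at ha'
  rw [M_of_conj h] at ha'
  exact ⟨α, ⟨a0, a1, lam, ha⟩, ⟨a0, a1, lam, ha'⟩⟩

end TwoSubst

open TwoSubst in
/-- For primitive invertible substitutions `σ, ρ` on two letters with
the same inflation factor, the following are equivalent: (i) `σ ~ ρ`; (ii) `X_σ = X_ρ`;
(iii) `σ` and `ρ` have the same frequency. -/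
theorem conj_iff_hull_iff_freq (σ ρ : Subst) (hneσ : NonErasing σ) (hneρ : NonErasing ρ)
    (hσ : Primitive σ) (hρ : Primitive ρ)
    (hiσ : IsInvertible σ) (hiρ : IsInvertible ρ)
    (hlam : ∃ lam : ℝ, IsInflation σ lam ∧ IsInflation ρ lam) :
    (Conj σ ρ ↔ Hull σ = Hull ρ) ∧
      (Conj σ ρ ↔ ∃ α : ℝ, IsFreq σ α ∧ IsFreq ρ α) := by
  have hf := conj_of_freq hσ hiσ hiρ hlam
  refine ⟨⟨fun h => Set.Subset.antisymm (hull_sub hneσ hρ (conj_symm h)) (hull_sub hneρ hσ h),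
    fun h => hf (freq_of_hull hσ hρ hiσ hiρ hlam h)⟩, ⟨freq_of_conj hlam, hf⟩⟩
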